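/- arXiv:1803.02986 — 8 statements merged into one kernel-verified Lean document; each statement's English description precedes it below -/
import Mathlib

section
/- Let (Ω, Σ, μ) be a measure space, let (f_n)_{n∈ℕ} be a sequence of nonnegative measurable real-valued functions on Ω, and let f be a nonnegative measurable real-valued function on Ω such that μ({f > 0}) < ∞ and μ({f > M}) → 0 as M → ∞. Assume that for every t ≥ 0 one has μ({f_n > t}) → μ({f > t}) as n → ∞, and that for Lebesgue-almost every t ≥ 0 one has μ(({f_n > t}) Δ ({f > t})) → 0 as n → ∞. Then f_n converges to f in μ-measure: for every s > 0, μ({x : |f_n(x) − f(x)| ≥ s}) → 0 as n → ∞. -/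
open MeasureTheory Filter Topology symmDiff

/-- A property holding almost everywhere on `[0, ∞)` holds somewhere in every interval
`(a, b)` with `0 ≤ a < b`. -/
lemma exists_mem_Ioo_of_ae_restrict_Ici {p : ℝ → Prop}
    (hp : ∀ᵐ t : ℝ ∂(volume.restrict (Set.Ici (0 : ℝ))), p t) {a b : ℝ}
    (ha : 0 ≤ a) (hab : a < b) : ∃ t ∈ Set.Ioo a b, p t := by
  by_contra! h
  have hp' := (ae_restrict_iff' measurableSet_Ici).1 hp
  have hsub : Set.Ioo a b ⊆ {t | ¬(t ∈ Set.Ici (0 : ℝ) → p t)} :=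
    fun t ht hpt => h t ht (hpt (ha.trans ht.1.le))
  have h0 : volume (Set.Ioo a b) = 0 := measure_mono_null hsub (ae_iff.1 hp')
  rw [Real.volume_Ioo, ENNReal.ofReal_eq_zero] at h0
  linarith

/-- If every `t i` lies in the `i`-th interval of length `s / 2`, two nonnegative numbers at
distance at least `s` are separated by some `t i` with `i ≤ N`, unless both exceed
`N * (s / 2)`. -/
lemma exists_separating_level {s : ℝ} (hs : 0 < s) {t : ℕ → ℝ}
    (ht : ∀ i : ℕ, t i ∈ Set.Ioo (i * (s / 2)) ((i + 1) * (s / 2))) (N : ℕ) {a b : ℝ}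
    (ha : 0 ≤ a) (hab : a + s ≤ b) :
    N * (s / 2) < a ∨ ∃ i ≤ N, a < t i ∧ t i < b := by
  have hs2 : 0 < s / 2 := by positivity
  rcases lt_or_ge N ⌈a / (s / 2)⌉₊ with hN | hN
  · left
    exact (lt_div_iff₀ hs2).1 (Nat.lt_ceil.1 hN)
  · right
    refine ⟨_, hN, ?_, ?_⟩
    · exact ((div_le_iff₀ hs2).1 (Nat.le_ceil _)).trans_lt (ht _).1
    · have h1 : (⌈a / (s / 2)⌉₊ : ℝ) - 1 < a / (s / 2) := by
        linarith [Nat.ceil_lt_add_one (div_nonneg ha hs2.le)]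
      have h2 := (lt_div_iff₀ hs2).1 h1
      linarith [(ht ⌈a / (s / 2)⌉₊).2]

/-- Criterion for convergence in measure: if the distribution functions of `fn` converge
pointwise to that of `f`, and for Lebesgue-a.e. `t ≥ 0` the measure of the symmetric
difference of the superlevel sets tends to `0`, then `fn → f` in `μ`-measure. -/
theorem stmt_0 {Ω : Type*} [MeasurableSpace Ω] (μ : Measure Ω)
    (f : Ω → ℝ) (fn : ℕ → Ω → ℝ)
    (hf_meas : Measurable f) (hfn_meas : ∀ n, Measurable (fn n))
    (hf_nonneg : ∀ x, 0 ≤ f x) (hfn_nonneg : ∀ n x, 0 ≤ fn n x)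
    (hfin : μ {x | 0 < f x} < ⊤)
    (htail : Tendsto (fun M : ℝ => μ {x | M < f x}) atTop (nhds 0))
    (hdist : ∀ t : ℝ, 0 ≤ t →
      Tendsto (fun n => μ {x | t < fn n x}) atTop (nhds (μ {x | t < f x})))
    (hsymm : ∀ᵐ t : ℝ ∂(volume.restrict (Set.Ici (0:ℝ))),
      Tendsto (fun n => μ ({x | t < fn n x} ∆ {x | t < f x})) atTop (nhds 0)) :
    ∀ s : ℝ, 0 < s →
      Tendsto (fun n => μ {x | s ≤ |fn n x - f x|}) atTop (nhds 0) := by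
  intro s hs
  choose t ht hconv using fun i : ℕ =>
    exists_mem_Ioo_of_ae_restrict_Ici hsymm (a := i * (s / 2)) (b := (i + 1) * (s / 2))
      (by positivity) (by linarith)
  have hsub (N n : ℕ) : {x | s ≤ |fn n x - f x|} ⊆ {x | N * (s / 2) < f x} ∪
      ⋃ i ∈ Finset.range (N + 1), ({x | t i < fn n x} ∆ {x | t i < f x}) := by
    intro x hx
    simp only [Set.mem_union, Set.mem_iUnion, Finset.mem_range, Set.mem_symmDiff,
      Set.mem_ofPred_eq, exists_prop, Nat.lt_succ_iff, not_lt] at hx ⊢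
    rcases le_abs.1 hx with h | h
    · rcases exists_separating_level hs ht N (hf_nonneg x)
        (show f x + s ≤ fn n x by linarith) with h' | ⟨i, hi, h1, h2⟩
      · exact Or.inl h'
      · exact Or.inr ⟨i, hi, Or.inl ⟨h2, h1.le⟩⟩
    · rcases exists_separating_level hs ht N (hfn_nonneg n x)
        (show fn n x + s ≤ f x by linarith) with h' | ⟨i, hi, h1, h2⟩
      · exact Or.inl (by linarith)
      · exact Or.inr ⟨i, hi, Or.inr ⟨h2, h1.le⟩⟩
  have htail' : Tendsto (fun N : ℕ => μ {x | N * (s / 2) < f x}) atTop (nhds 0) :=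
    htail.comp (tendsto_natCast_atTop_atTop.atTop_mul_const (half_pos hs))
  refine ENNReal.tendsto_nhds_zero.2 fun ε hε => ?_
  have hε2 : 0 < ε / 2 := ENNReal.half_pos hε.ne'
  obtain ⟨N, hN⟩ := (ENNReal.tendsto_nhds_zero.1 htail' _ hε2).exists
  have hsum : Tendsto (fun n => ∑ i ∈ Finset.range (N + 1),
      μ ({x | t i < fn n x} ∆ {x | t i < f x})) atTop (nhds 0) := by
    simpa using tendsto_finsetSum (Finset.range (N + 1)) fun i _ => hconv i
  filter_upwards [ENNReal.tendsto_nhds_zero.1 hsum _ hε2] with n hn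
  calc μ {x | s ≤ |fn n x - f x|}
      ≤ μ {x | N * (s / 2) < f x} +
          μ (⋃ i ∈ Finset.range (N + 1), ({x | t i < fn n x} ∆ {x | t i < f x})) :=
        (measure_mono (hsub N n)).trans (measure_union_le _ _)
    _ ≤ ε / 2 + ε / 2 :=
        add_le_add hN ((measure_biUnion_finset_le _ _).trans hn)
    _ = ε := ENNReal.add_halves ε
end

section
/- Let (Ω, Σ, μ) be a measure space and let f, g : Ω → [0, ∞) be measurable functions. Then for every s > 0 and every M > 0 one has μ({x : |f(x) − g(x)| ≥ s}) ≤ (2/s) ∫₀^M μ(({f > t}) Δ ({g > t})) dt + μ({f > M}) + μ({g > M}), where the integral in t is the Lebesgue integral of the (possibly infinite-valued) function t ↦ μ(({f > t}) Δ ({g > t})) over [0, M], and the inequality is understood in [0, ∞]. -/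
open MeasureTheory Filter Topology symmDiff

/-- Membership of `x` in `{f > t} ∆ {g > t}` for `t` in the half-open interval between the values. -/
lemma mem_symmDiff_superlevel {Ω : Type*} {f g : Ω → ℝ} {x : Ω} {t : ℝ}
    (h₁ : min (f x) (g x) ≤ t) (h₂ : t < max (f x) (g x)) :
    x ∈ {x | t < f x} ∆ {x | t < g x} := by
  simp only [Set.mem_symmDiff, Set.mem_ofPred_eq, not_lt]
  rcases min_le_iff.1 h₁ with h | h <;> rcases lt_max_iff.1 h₂ with h' | h'
  · exact absurd h' h.not_gt
  · exact Or.inr ⟨h', h⟩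
  · exact Or.inl ⟨h', h⟩
  · exact absurd h' h.not_gt

lemma measurableSet_symmDiff_superlevel {Ω : Type*} [MeasurableSpace Ω] {f g : Ω → ℝ}
    (hf : Measurable f) (hg : Measurable g) (t : ℝ) :
    MeasurableSet ({x | t < f x} ∆ {x | t < g x}) :=
  (measurableSet_lt measurable_const hf).symmDiff (measurableSet_lt measurable_const hg)

/-- A measure is σ-finite on a countable union of measurable sets of finite measure. -/
lemma sigmaFinite_restrict_iUnion_of_lt_top {Ω ι : Type*} [MeasurableSpace Ω] [Countable ι]
    (μ : Measure Ω) {E : ι → Set Ω} (hE : ∀ i, MeasurableSet (E i)) (hμ : ∀ i, μ (E i) < ⊤) :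
    SigmaFinite (μ.restrict (⋃ i, E i)) := by
  refine Measure.sigmaFinite_of_countable (S := insert (⋃ i, E i)ᶜ (Set.range E))
    ((Set.countable_range E).insert _) ?_ ?_
  · rintro _ (rfl | ⟨i, rfl⟩)
    · rw [Measure.restrict_apply (MeasurableSet.iUnion hE).compl,
        Set.compl_inter_self, measure_empty]
      exact ENNReal.zero_lt_top
    · exact (Measure.restrict_apply_le _ _).trans_lt (hμ i)
  · rw [Set.sUnion_insert, Set.sUnion_range, Set.compl_union_self]

/-- If the integral of `t ↦ μ({f > t} ∆ {g > t})` over `[0, M]` is finite, then every nonempty open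
interval in `[0, M]` contains a level `t` at which the symmetric difference has finite measure. -/
lemma exists_finite_symmDiff_superlevel {Ω : Type*} [MeasurableSpace Ω] (μ : Measure Ω)
    (f g : Ω → ℝ) {M : ℝ}
    (hI : ∫⁻ t in Set.Icc (0:ℝ) M, μ ({x | t < f x} ∆ {x | t < g x}) ≠ ⊤)
    {q r : ℝ} (hq : 0 ≤ q) (hqr : q < r) (hr : r ≤ M) :
    ∃ t ∈ Set.Ioo q r, μ ({x | t < f x} ∆ {x | t < g x}) < ⊤ := by
  by_contra! h
  refine hI (top_le_iff.1 ?_)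
  calc (⊤ : ENNReal) = ∫⁻ _ in Set.Ioo q r, ⊤ := by
        rw [setLIntegral_const, Real.volume_Ioo, ENNReal.top_mul]
        simpa using hqr
    _ ≤ ∫⁻ t in Set.Ioo q r, μ ({x | t < f x} ∆ {x | t < g x}) :=
        setLIntegral_mono' measurableSet_Ioo h
    _ ≤ _ := lintegral_mono_set (Set.Ioo_subset_Icc_self.trans (Set.Icc_subset_Icc hq hr))

/-- For an s-finite measure, Tonelli's theorem bounds the measure of a set on which `f` and `g` take
values in `[0, M]` and differ by at least `s`. -/
lemma mul_measure_le_lintegral_symmDiff_superlevel {Ω : Type*} [MeasurableSpace Ω]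
    (μ : Measure Ω) [SFinite μ] {f g : Ω → ℝ} (hf : Measurable f) (hg : Measurable g)
    {s M : ℝ} {A : Set Ω} (hA : ∀ x ∈ A, 0 ≤ f x ∧ 0 ≤ g x ∧ f x ≤ M ∧ g x ≤ M ∧ s ≤ |f x - g x|)
    (hAm : MeasurableSet A) :
    ENNReal.ofReal s * μ A ≤
      ∫⁻ t in Set.Icc (0:ℝ) M, μ ({x | t < f x} ∆ {x | t < g x}) := by
  set P : Set (Ω × ℝ) := {p | p.2 < f p.1} ∆ {p | p.2 < g p.1}
  have hPm : MeasurableSet P :=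
    (measurableSet_lt measurable_snd (hf.comp measurable_fst)).symmDiff
      (measurableSet_lt measurable_snd (hg.comp measurable_fst))
  calc ENNReal.ofReal s * μ A = ∫⁻ _ in A, ENNReal.ofReal s ∂μ := (setLIntegral_const _ _).symm
    _ ≤ ∫⁻ x in A, (volume.restrict (Set.Icc (0:ℝ) M)) (Prod.mk x ⁻¹' P) ∂μ := by
        refine setLIntegral_mono' hAm fun x hx => ?_
        obtain ⟨hf0, hg0, hfM, hgM, hs⟩ := hA x hx
        rw [Measure.restrict_apply (measurable_prodMk_left hPm)]
        calc ENNReal.ofReal s ≤ volume (Set.Ico (min (f x) (g x)) (max (f x) (g x))) := by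
              rw [Real.volume_Ico, max_sub_min_eq_abs']
              exact ENNReal.ofReal_le_ofReal hs
          _ ≤ volume (Prod.mk x ⁻¹' P ∩ Set.Icc (0:ℝ) M) := measure_mono fun t ht =>
              ⟨mem_symmDiff_superlevel ht.1 ht.2, (le_min hf0 hg0).trans ht.1,
                ht.2.le.trans (max_le hfM hgM)⟩
    _ ≤ ∫⁻ x, (volume.restrict (Set.Icc (0:ℝ) M)) (Prod.mk x ⁻¹' P) ∂μ :=
        setLIntegral_le_lintegral _ _
    _ = _ := by
        rw [← Measure.prod_apply hPm, Measure.prod_apply_symm hPm]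
        rfl

/-- For nonnegative measurable `f, g`, the measure of `{|f − g| ≥ s}` is controlled by
`(2/s) ∫₀^M μ({f > t} ∆ {g > t}) dt + μ({f > M}) + μ({g > M})`, in `[0, ∞]`. -/
theorem stmt_1 {Ω : Type*} [MeasurableSpace Ω] (μ : Measure Ω)
    (f g : Ω → ℝ) (hf_meas : Measurable f) (hg_meas : Measurable g)
    (hf_nonneg : ∀ x, 0 ≤ f x) (hg_nonneg : ∀ x, 0 ≤ g x)
    (s M : ℝ) (hs : 0 < s) (hM : 0 < M) :
    μ {x | s ≤ |f x - g x|} ≤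
      ENNReal.ofReal (2 / s) *
          (∫⁻ t in Set.Icc (0:ℝ) M, μ ({x | t < f x} ∆ {x | t < g x}))
        + μ {x | M < f x} + μ {x | M < g x} := by
  by_cases hI : ∫⁻ t in Set.Icc (0:ℝ) M, μ ({x | t < f x} ∆ {x | t < g x}) = ⊤
  · rw [hI, ENNReal.mul_top (by simpa using hs)]
    simp
  set A : Set Ω := {x | s ≤ |f x - g x|} ∩ ({x | f x ≤ M} ∩ {x | g x ≤ M})
  have hAm : MeasurableSet A :=
    (measurableSet_le measurable_const (hf_meas.sub hg_meas).abs).inter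
      ((measurableSet_le hf_meas measurable_const).inter
        (measurableSet_le hg_meas measurable_const))
  have hcover : {x | s ≤ |f x - g x|} ⊆ A ∪ {x | M < f x} ∪ {x | M < g x} := by
    intro x hx
    by_cases h₁ : M < f x
    · exact Or.inl (Or.inr h₁)
    by_cases h₂ : M < g x
    · exact Or.inr h₂
    exact Or.inl (Or.inl ⟨hx, not_lt.1 h₁, not_lt.1 h₂⟩)
  have hlevel : ∀ p : ℚ × ℚ, ∃ t : ℝ, μ ({x | t < f x} ∆ {x | t < g x}) < ⊤ ∧
      (0 ≤ (p.1 : ℝ) → (p.1 : ℝ) < p.2 → (p.2 : ℝ) ≤ M → t ∈ Set.Ioo (p.1 : ℝ) p.2) := by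
    intro p
    by_cases h : 0 ≤ (p.1 : ℝ) ∧ (p.1 : ℝ) < p.2 ∧ (p.2 : ℝ) ≤ M
    · obtain ⟨t, ht, hμ⟩ := exists_finite_symmDiff_superlevel μ f g hI h.1 h.2.1 h.2.2
      exact ⟨t, hμ, fun _ _ _ => ht⟩
    · refine ⟨-1, ?_, fun h₁ h₂ h₃ => absurd ⟨h₁, h₂, h₃⟩ h⟩
      have hu : ∀ {u : Ω → ℝ}, (∀ x, 0 ≤ u x) → {x | (-1 : ℝ) < u x} = Set.univ :=
        fun hu => Set.eq_univ_of_forall fun x => neg_one_lt_zero.trans_le (hu x)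
      rw [hu hf_nonneg, hu hg_nonneg, symmDiff_self]
      simp
  choose τ hτ_fin hτ using hlevel
  set B : Set Ω := ⋃ p, ({x | τ p < f x} ∆ {x | τ p < g x})
  have hAB : A ⊆ B := by
    rintro x ⟨hx, hfM, hgM⟩
    have hlt : min (f x) (g x) < max (f x) (g x) := by
      rw [← sub_pos, max_sub_min_eq_abs']
      exact hs.trans_le hx
    obtain ⟨q, hq₁, hq₂⟩ := exists_rat_btwn hlt
    obtain ⟨r, hr₁, hr₂⟩ := exists_rat_btwn hq₂
    have ht := hτ (q, r) ((le_min (hf_nonneg x) (hg_nonneg x)).trans hq₁.le) hr₁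
      (hr₂.le.trans (max_le hfM hgM))
    exact Set.mem_iUnion.2
      ⟨(q, r), mem_symmDiff_superlevel (hq₁.trans ht.1).le (ht.2.trans hr₂)⟩
  have : SigmaFinite (μ.restrict B) := sigmaFinite_restrict_iUnion_of_lt_top μ
    (fun p => measurableSet_symmDiff_superlevel hf_meas hg_meas (τ p)) hτ_fin
  have hmul : ENNReal.ofReal s * μ A ≤
      ∫⁻ t in Set.Icc (0:ℝ) M, μ ({x | t < f x} ∆ {x | t < g x}) := by
    rw [← Measure.restrict_eq_self μ hAB]
    refine (mul_measure_le_lintegral_symmDiff_superlevel (μ.restrict B) hf_meas hg_meas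
      (fun x hx => ⟨hf_nonneg x, hg_nonneg x, hx.2.1, hx.2.2, hx.1⟩) hAm).trans ?_
    exact lintegral_mono fun t => Measure.restrict_apply_le _ _
  have hAle : μ A ≤ ENNReal.ofReal (2 / s) *
      ∫⁻ t in Set.Icc (0:ℝ) M, μ ({x | t < f x} ∆ {x | t < g x}) :=
    calc μ A ≤ ENNReal.ofReal (2 / s) * (ENNReal.ofReal s * μ A) := by
          rw [← mul_assoc, ← ENNReal.ofReal_mul (by positivity), div_mul_cancel₀ _ hs.ne']
          exact le_mul_of_one_le_left' (by simp)
      _ ≤ _ := by gcongr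
  calc μ {x | s ≤ |f x - g x|} ≤ μ (A ∪ {x | M < f x} ∪ {x | M < g x}) := measure_mono hcover
    _ ≤ μ A + μ {x | M < f x} + μ {x | M < g x} :=
        (measure_union_le _ _).trans (by gcongr; exact measure_union_le _ _)
    _ ≤ _ := by gcongr
end

section
/- Let Ω be a set and let f, g : Ω → [0, ∞) be functions. Then for every s > 0, every M > 0 and every x ∈ Ω one has the pointwise inequality 𝟙_{{|f−g| ≥ s}}(x) ≤ (2/s) ∫₀^M 𝟙_{({f > t}) Δ ({g > t})}(x) dt + 𝟙_{{f > M}}(x) + 𝟙_{{g > M}}(x), where 𝟙_A denotes the indicator function of the set A and the integral in t is a Lebesgue integral over [0, M]. -/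
open MeasureTheory Filter Topology symmDiff

/-- The layer `t` separates `f` from `g` at `x` exactly when `t` lies between the two values. -/
lemma indicator_superlevel_symmDiff {Ω : Type*} (f g : Ω → ℝ) (x : Ω) (t : ℝ) :
    Set.indicator ({y | t < f y} ∆ {y | t < g y}) (fun _ => (1 : ℝ)) x =
      Set.indicator (Set.Ico (min (f x) (g x)) (max (f x) (g x))) (fun _ => (1 : ℝ)) t := by
  have h : x ∈ ({y | t < f y} ∆ {y | t < g y} : Set Ω) ↔
      t ∈ Set.Ico (min (f x) (g x)) (max (f x) (g x)) := by
    simp only [Set.mem_symmDiff, Set.mem_ofPred_eq, Set.mem_Ico, min_le_iff, lt_max_iff, not_lt]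
    grind
  by_cases ht : t ∈ Set.Ico (min (f x) (g x)) (max (f x) (g x))
  · rw [Set.indicator_of_mem ht, Set.indicator_of_mem (h.mpr ht)]
  · rw [Set.indicator_of_notMem ht, Set.indicator_of_notMem (mt h.mp ht)]

/-- When both values lie in `[0, M]`, integrating over the layers recovers `|f x - g x|`. -/
lemma setIntegral_indicator_superlevel_symmDiff {Ω : Type*} (f g : Ω → ℝ) {M : ℝ} {x : Ω}
    (hf : 0 ≤ f x) (hg : 0 ≤ g x) (hfM : f x ≤ M) (hgM : g x ≤ M) :
    ∫ t in Set.Icc (0 : ℝ) M,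
      Set.indicator ({y | t < f y} ∆ {y | t < g y}) (fun _ => (1 : ℝ)) x = |f x - g x| := by
  simp_rw [indicator_superlevel_symmDiff]
  have hsub : Set.Ico (min (f x) (g x)) (max (f x) (g x)) ⊆ Set.Icc 0 M := fun t ht =>
    ⟨(le_min hf hg).trans ht.1, ht.2.le.trans (max_le hfM hgM)⟩
  rw [setIntegral_indicator measurableSet_Ico, Set.inter_eq_right.mpr hsub, setIntegral_const,
    Real.volume_real_Ico_of_le min_le_max, smul_eq_mul, mul_one, max_sub_min_eq_abs']

/-- Pointwise inequality between indicator functions: for nonnegative `f, g` and every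
`s > 0`, `M > 0` and `x`, the indicator of `{|f − g| ≥ s}` at `x` is bounded by
`(2/s) ∫₀^M 𝟙_{({f > t}) ∆ ({g > t})}(x) dt + 𝟙_{{f > M}}(x) + 𝟙_{{g > M}}(x)`. -/
theorem stmt_2 {Ω : Type*} (f g : Ω → ℝ)
    (hf_nonneg : ∀ x, 0 ≤ f x) (hg_nonneg : ∀ x, 0 ≤ g x)
    (s M : ℝ) (hs : 0 < s) (hM : 0 < M) (x : Ω) :
    Set.indicator {y | s ≤ |f y - g y|} (fun _ => (1:ℝ)) x ≤
      (2 / s) *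
          (∫ t in Set.Icc (0:ℝ) M,
            Set.indicator ({y | t < f y} ∆ {y | t < g y}) (fun _ => (1:ℝ)) x)
        + Set.indicator {y | M < f y} (fun _ => (1:ℝ)) x
        + Set.indicator {y | M < g y} (fun _ => (1:ℝ)) x := by
  have hI : 0 ≤ (2 / s) * ∫ t in Set.Icc (0:ℝ) M,
      Set.indicator ({y | t < f y} ∆ {y | t < g y}) (fun _ => (1:ℝ)) x :=
    mul_nonneg (by positivity) (integral_nonneg fun t =>
      Set.indicator_nonneg (fun _ _ => zero_le_one) x)
  have hF : 0 ≤ Set.indicator {y | M < f y} (fun _ => (1:ℝ)) x :=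
    Set.indicator_nonneg (fun _ _ => zero_le_one) x
  have hG : 0 ≤ Set.indicator {y | M < g y} (fun _ => (1:ℝ)) x :=
    Set.indicator_nonneg (fun _ _ => zero_le_one) x
  by_cases hx : s ≤ |f x - g x|
  · rw [Set.indicator_of_mem (show x ∈ {y | s ≤ |f y - g y|} from hx)]
    rcases lt_or_ge M (f x) with hfM | hfM
    · rw [Set.indicator_of_mem (show x ∈ {y | M < f y} from hfM)]
      linarith
    rcases lt_or_ge M (g x) with hgM | hgM
    · rw [Set.indicator_of_mem (show x ∈ {y | M < g y} from hgM)]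
      linarith
    rw [setIntegral_indicator_superlevel_symmDiff f g (hf_nonneg x) (hg_nonneg x) hfM hgM]
    have h : 2 / s * s ≤ 2 / s * |f x - g x| := by gcongr
    rw [div_mul_cancel₀ _ hs.ne'] at h
    linarith
  · rw [Set.indicator_of_notMem (show x ∉ {y | s ≤ |f y - g y|} from hx)]
    positivity
end

section
/- Cavalieri's principle for L¹ distances: let (Ω, Σ, μ) be a measure space and let f, g : Ω → [0, ∞) be measurable functions. Then ∫_Ω |f − g| dμ = ∫₀^∞ μ(({f > t}) Δ ({g > t})) dt, as an identity in [0, ∞], where both sides are understood as Lebesgue integrals of nonnegative (possibly infinite-valued) functions. -/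
open MeasureTheory Filter Topology symmDiff

/-- The restriction of a measure to a measurable set covered by countably many sets of finite
measure is σ-finite. -/
theorem sigmaFinite_restrict_of_subset_iUnion {Ω ι : Type*} [MeasurableSpace Ω] [Countable ι]
    {μ : Measure Ω} {A : Set Ω} (hA : MeasurableSet A) (S : ι → Set Ω)
    (hS : ∀ i, μ (S i) < ⊤) (hcover : A ⊆ ⋃ i, S i) : SigmaFinite (μ.restrict A) := by
  refine Measure.sigmaFinite_of_countable (S := insert Aᶜ (Set.range S))
    ((Set.countable_range S).insert _) ?_ ?_
  · rintro s (rfl | ⟨i, rfl⟩)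
    · simp [Measure.restrict_apply hA.compl]
    · exact (Measure.restrict_apply_le A (S i)).trans_lt (hS i)
  · refine Set.eq_univ_of_forall fun x => ?_
    by_cases hx : x ∈ A
    · obtain ⟨i, hi⟩ := Set.mem_iUnion.1 (hcover hx)
      exact ⟨S i, Or.inr ⟨i, rfl⟩, hi⟩
    · exact ⟨Aᶜ, Or.inl rfl, hx⟩

/-- Membership in the symmetric difference of two superlevel sets. -/
theorem mem_symmDiff_superlevel_iff {Ω : Type*} (f g : Ω → ℝ) (t : ℝ) (x : Ω) :
    x ∈ {x | t < f x} ∆ {x | t < g x} ↔ t ∈ Set.Ico (min (f x) (g x)) (max (f x) (g x)) := by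
  simp only [Set.mem_symmDiff, Set.mem_ofPred_eq, Set.mem_Ico, min_le_iff, lt_max_iff]
  grind

/-- Cavalieri's principle for `L¹` distances over an s-finite measure. -/
theorem lintegral_abs_sub_eq_of_sFinite {Ω : Type*} [MeasurableSpace Ω] (μ : Measure Ω) [SFinite μ]
    (f g : Ω → ℝ) (hf_meas : Measurable f) (hg_meas : Measurable g)
    (hf_nonneg : ∀ x, 0 ≤ f x) (hg_nonneg : ∀ x, 0 ≤ g x) :
    ∫⁻ x, ENNReal.ofReal |f x - g x| ∂μ =
      ∫⁻ t in Set.Ioi (0:ℝ), μ ({x | t < f x} ∆ {x | t < g x}) := by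
  have hE : MeasurableSet {p : Ω × ℝ | p.1 ∈ {x | p.2 < f x} ∆ {x | p.2 < g x}} :=
    (measurableSet_lt measurable_snd (hf_meas.comp measurable_fst)).symmDiff
      (measurableSet_lt measurable_snd (hg_meas.comp measurable_fst))
  set E := {p : Ω × ℝ | p.1 ∈ {x | p.2 < f x} ∆ {x | p.2 < g x}}
  have hswap := lintegral_lintegral_swap (μ := μ) (ν := volume.restrict (Set.Ioi (0:ℝ)))
    (f := fun x t => E.indicator 1 (x, t)) (measurable_one.indicator hE).aemeasurable
  calc
    _ = ∫⁻ x, (∫⁻ t in Set.Ioi (0:ℝ), E.indicator 1 (x, t)) ∂μ := by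
      refine lintegral_congr fun x => ?_
      have hIco : Prod.mk x ⁻¹' E = Set.Ico (min (f x) (g x)) (max (f x) (g x)) :=
        Set.ext fun t => mem_symmDiff_superlevel_iff f g t x
      have hsub : Set.Ico (min (f x) (g x)) (max (f x) (g x)) ⊆ Set.Ici 0 :=
        fun t ht => (le_min (hf_nonneg x) (hg_nonneg x)).trans ht.1
      have hint : ∫⁻ t in Set.Ioi (0:ℝ), E.indicator 1 (x, t) =
          volume.restrict (Set.Ioi (0:ℝ)) (Prod.mk x ⁻¹' E) :=
        lintegral_indicator_one (measurable_prodMk_left hE)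
      rw [hint, hIco, Measure.restrict_congr_set Ioi_ae_eq_Ici,
        Measure.restrict_apply measurableSet_Ico,
        Set.inter_eq_left.2 hsub, Real.volume_Ico, max_sub_min_eq_abs']
    _ = ∫⁻ t in Set.Ioi (0:ℝ), (∫⁻ x, E.indicator 1 (x, t) ∂μ) := hswap
    _ = _ := lintegral_congr fun t =>
      lintegral_indicator_one (μ := μ) (measurable_prodMk_right (y := t) hE)

/-- If `f` and `g` have finite `L¹` distance, then `μ` is σ-finite on `{f ≠ g}`. -/
theorem sigmaFinite_restrict_ne_of_lintegral_ne_top {Ω : Type*} [MeasurableSpace Ω] {μ : Measure Ω}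
    {f g : Ω → ℝ} (hf_meas : Measurable f) (hg_meas : Measurable g)
    (h : ∫⁻ x, ENNReal.ofReal |f x - g x| ∂μ ≠ ⊤) :
    SigmaFinite (μ.restrict {x | f x ≠ g x}) := by
  refine sigmaFinite_restrict_of_subset_iUnion (measurableSet_eq_fun hf_meas hg_meas).compl
    (fun n : ℕ => {x | ((n + 1 : ℕ) : ENNReal)⁻¹ ≤ ENNReal.ofReal |f x - g x|})
    (fun n => ?_) fun x hx => ?_
  · exact (meas_ge_le_lintegral_div (hf_meas.sub hg_meas).abs.ennreal_ofReal.aemeasurable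
      (ENNReal.inv_ne_zero.2 (ENNReal.natCast_ne_top _))
      (ENNReal.inv_ne_top.2 (Nat.cast_ne_zero.2 n.succ_ne_zero))).trans_lt (ENNReal.div_lt_top h
        (ENNReal.inv_ne_zero.2 (ENNReal.natCast_ne_top _)))
  · have hpos : ENNReal.ofReal |f x - g x| ≠ 0 := by
      simpa [sub_eq_zero] using hx
    obtain ⟨n, hn⟩ := ENNReal.exists_inv_nat_lt hpos
    exact Set.mem_iUnion.2 ⟨n, (ENNReal.inv_le_inv.2 (Nat.cast_le.2 n.le_succ)).trans hn.le⟩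

/-- If the symmetric differences of the superlevel sets of two nonnegative functions have
integrable measure, then `μ` is σ-finite on `{f ≠ g}`. -/
theorem sigmaFinite_restrict_ne_of_lintegral_symmDiff_ne_top {Ω : Type*} [MeasurableSpace Ω]
    {μ : Measure Ω} {f g : Ω → ℝ} (hf_meas : Measurable f) (hg_meas : Measurable g)
    (hf_nonneg : ∀ x, 0 ≤ f x) (hg_nonneg : ∀ x, 0 ≤ g x)
    (h : ∫⁻ t in Set.Ioi (0:ℝ), μ ({x | t < f x} ∆ {x | t < g x}) ≠ ⊤) :
    SigmaFinite (μ.restrict {x | f x ≠ g x}) := by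
  have hlevel : ∀ p : {p : ℚ × ℚ // 0 ≤ p.1 ∧ p.1 < p.2}, ∃ t ∈ Set.Ioo (p.1.1 : ℝ) p.1.2,
      μ ({x | t < f x} ∆ {x | t < g x}) < ⊤ := by
    rintro ⟨⟨a, b⟩, ha, hab⟩
    by_contra! hinf
    have ha' : (0:ℝ) ≤ a := by exact_mod_cast ha
    have hab' : (a:ℝ) < b := by exact_mod_cast hab
    refine h (top_le_iff.1 ?_)
    calc
      (⊤ : ENNReal) = ∫⁻ _ in Set.Ioo (a:ℝ) b, ⊤ := by
        rw [setLIntegral_const, Real.volume_Ioo,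
          ENNReal.top_mul (ENNReal.ofReal_pos.2 (sub_pos.2 hab')).ne']
      _ ≤ ∫⁻ t in Set.Ioo (a:ℝ) b, μ ({x | t < f x} ∆ {x | t < g x}) :=
        setLIntegral_mono' measurableSet_Ioo hinf
      _ ≤ _ := lintegral_mono_set fun t ht => ha'.trans_lt ht.1
  choose t ht hfin using hlevel
  refine sigmaFinite_restrict_of_subset_iUnion (measurableSet_eq_fun hf_meas hg_meas).compl
    (fun p => {x | t p < f x} ∆ {x | t p < g x}) hfin fun x hx => ?_
  obtain ⟨a, hfa, hab⟩ := exists_rat_btwn (min_lt_max.2 hx)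
  obtain ⟨b, hab, hbg⟩ := exists_rat_btwn hab
  have ha : (0:ℝ) ≤ a := (le_min (hf_nonneg x) (hg_nonneg x)).trans hfa.le
  let p : {p : ℚ × ℚ // 0 ≤ p.1 ∧ p.1 < p.2} :=
    ⟨(a, b), by exact_mod_cast ha, by exact_mod_cast hab⟩
  exact Set.mem_iUnion.2 ⟨p, (mem_symmDiff_superlevel_iff f g _ x).2
    ⟨(hfa.trans (ht p).1).le, (ht p).2.trans hbg⟩⟩

/-- Cavalieri's principle for `L¹` distances: for nonnegative measurable `f, g`,
`∫_Ω |f − g| dμ = ∫₀^∞ μ({f > t} ∆ {g > t}) dt`, as an identity in `[0, ∞]`. -/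
theorem stmt_3 {Ω : Type*} [MeasurableSpace Ω] (μ : Measure Ω)
    (f g : Ω → ℝ) (hf_meas : Measurable f) (hg_meas : Measurable g)
    (hf_nonneg : ∀ x, 0 ≤ f x) (hg_nonneg : ∀ x, 0 ≤ g x) :
    ∫⁻ x, ENNReal.ofReal |f x - g x| ∂μ =
      ∫⁻ t in Set.Ioi (0:ℝ), μ ({x | t < f x} ∆ {x | t < g x}) := by
  by_cases hσ : SigmaFinite (μ.restrict {x | f x ≠ g x})
  · have key := lintegral_abs_sub_eq_of_sFinite (μ.restrict {x | f x ≠ g x}) f g hf_meas hg_meas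
      hf_nonneg hg_nonneg
    have hleft : ∫⁻ x in {x | f x ≠ g x}, ENNReal.ofReal |f x - g x| ∂μ =
        ∫⁻ x, ENNReal.ofReal |f x - g x| ∂μ := by
      refine setLIntegral_eq_of_support_subset fun x hx heq => hx ?_
      simp [heq]
    rw [← hleft, key]
    refine lintegral_congr fun t => Measure.restrict_eq_self _ fun x hx heq => ?_
    have hmem := (mem_symmDiff_superlevel_iff f g t x).1 hx
    exact (min_lt_max.1 (hmem.1.trans_lt hmem.2)) heq
  · have hleft : ∫⁻ x, ENNReal.ofReal |f x - g x| ∂μ = ⊤ := by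
      by_contra h
      exact hσ (sigmaFinite_restrict_ne_of_lintegral_ne_top hf_meas hg_meas h)
    have hright : ∫⁻ t in Set.Ioi (0:ℝ), μ ({x | t < f x} ∆ {x | t < g x}) = ⊤ := by
      by_contra h
      exact hσ (sigmaFinite_restrict_ne_of_lintegral_symmDiff_ne_top hf_meas hg_meas
        hf_nonneg hg_nonneg h)
    rw [hleft, hright]
end

section
/- Contraction property of symmetrization around a point: let μ be a measure on ℝ² (with its Borel σ-algebra), let x ∈ ℝ², and let f₁, f₂, g₁, g₂ : ℝ² → [0, ∞) be measurable functions such that for every λ > 0 and each i ∈ {1, 2}, the superlevel set {g_i ≥ λ} is either empty or a closed ball centered at x, and μ({g_i ≥ λ}) = μ({f_i ≥ λ}) < ∞. Then ∫_{ℝ²} |g₁ − g₂| dμ ≤ ∫_{ℝ²} |f₁ − f₂| dμ, as an inequality in [0, ∞]. -/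
open MeasureTheory Filter Topology

/-- Layer-cake formula for the `L¹` distance of two nonnegative functions. -/
theorem lintegral_abs_sub_eq_lintegral_measure_uIoc {α : Type*} [MeasurableSpace α]
    (μ : Measure α) {f g : α → ℝ} (hf : Measurable f) (hg : Measurable g)
    (hf0 : ∀ y, 0 ≤ f y) (hg0 : ∀ y, 0 ≤ g y)
    (hfμ : ∀ t : ℝ, 0 < t → μ {y | t ≤ f y} < ⊤) (hgμ : ∀ t : ℝ, 0 < t → μ {y | t ≤ g y} < ⊤) :
    ∫⁻ y, ENNReal.ofReal |f y - g y| ∂μ = ∫⁻ t : ℝ, μ {y | t ∈ Set.uIoc (f y) (g y)} := by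
  set U : Set α := {y | 0 < f y} ∪ {y | 0 < g y} with hU
  have hUm : MeasurableSet U :=
    (measurableSet_lt measurable_const hf).union (measurableSet_lt measurable_const hg)
  have : SigmaFinite (μ.restrict U) := by
    refine ⟨⟨⟨fun n => Uᶜ ∪ ({y | (1 / ((n : ℝ) + 1)) ≤ f y} ∪ {y | (1 / ((n : ℝ) + 1)) ≤ g y}),
      fun _ => trivial, fun n => ?_, ?_⟩⟩⟩
    · have hn : (0 : ℝ) < 1 / ((n : ℝ) + 1) := by positivity
      refine measure_union_lt_top ?_ (measure_union_lt_top ?_ ?_)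
      · simp [Measure.restrict_apply hUm.compl]
      · exact (Measure.restrict_apply_le _ _).trans_lt (hfμ _ hn)
      · exact (Measure.restrict_apply_le _ _).trans_lt (hgμ _ hn)
    · refine Set.eq_univ_of_forall fun y => Set.mem_iUnion.2 ?_
      by_cases hy : y ∈ U
      · rcases hy with hy | hy
        · obtain ⟨n, hn⟩ := exists_nat_one_div_lt (show 0 < f y from hy)
          exact ⟨n, Or.inr (Or.inl hn.le)⟩
        · obtain ⟨n, hn⟩ := exists_nat_one_div_lt (show 0 < g y from hy)
          exact ⟨n, Or.inr (Or.inr hn.le)⟩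
      · exact ⟨0, Or.inl hy⟩
  have hT : MeasurableSet {p : ℝ × α | p.1 ∈ Set.uIoc (f p.2) (g p.2)} := by
    simp only [Set.uIoc, Set.mem_Ioc]
    exact (measurableSet_lt (by fun_prop) measurable_fst).inter
      (measurableSet_le measurable_fst (by fun_prop))
  calc ∫⁻ y, ENNReal.ofReal |f y - g y| ∂μ
      = ∫⁻ y in U, ENNReal.ofReal |f y - g y| ∂μ := by
        refine (setLIntegral_eq_of_support_subset ?_).symm
        intro y hy
        by_contra hyU
        simp only [hU, Set.mem_union, Set.mem_ofPred_eq, not_or, not_lt] at hyU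
        apply hy
        simp [le_antisymm hyU.1 (hf0 y), le_antisymm hyU.2 (hg0 y)]
    _ = ((volume : Measure ℝ).prod (μ.restrict U))
          {p : ℝ × α | p.1 ∈ Set.uIoc (f p.2) (g p.2)} := by
        rw [Measure.prod_apply_symm hT]
        refine lintegral_congr fun y => ?_
        change _ = volume (Set.uIoc (f y) (g y))
        rw [Real.volume_uIoc, abs_sub_comm]
    _ = ∫⁻ t : ℝ, μ {y | t ∈ Set.uIoc (f y) (g y)} := by
        rw [Measure.prod_apply hT]
        refine lintegral_congr fun t => ?_
        change μ.restrict U {y | t ∈ Set.uIoc (f y) (g y)} = _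
        rw [Measure.restrict_apply' hUm, Set.inter_eq_left.2]
        intro y hy
        rcases Set.mem_uIoc.1 hy with h | h
        · exact Or.inr ((hf0 y).trans_lt (h.1.trans_le h.2))
        · exact Or.inl ((hg0 y).trans_lt (h.1.trans_le h.2))

/-- The level slices of `|f - g|` are the symmetric differences of the superlevel sets. -/
theorem setOf_mem_uIoc_eq_symmDiff {α : Type*} (f g : α → ℝ) (t : ℝ) :
    {y | t ∈ Set.uIoc (f y) (g y)} = symmDiff {y | t ≤ f y} {y | t ≤ g y} := by
  ext y
  simp only [Set.mem_uIoc, Set.mem_symmDiff, Set.mem_ofPred_eq, not_le]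
  tauto

/-- Among pairs of sets of given finite measures, nested pairs have the smallest
symmetric difference. -/
theorem measure_symmDiff_le_of_subset {α : Type*} [MeasurableSpace α] {μ : Measure α}
    {A B C D : Set α} (hA : MeasurableSet A) (hAB : A ⊆ B) (hAC : μ A = μ C) (hBD : μ B = μ D)
    (hC : μ C < ⊤) : μ (symmDiff A B) ≤ μ (symmDiff C D) := by
  rw [symmDiff_of_le hAB, measure_sdiff hAB hA.nullMeasurableSet (hAC ▸ hC.ne), hAC, hBD]
  exact le_measure_sdiff.trans (measure_mono le_sup_right)

/-- Concentric balls are nested. -/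
theorem subset_or_subset_of_closedBall {α : Type*} [PseudoMetricSpace α] {x : α} {A B : Set α}
    (hA : A = ∅ ∨ ∃ r : ℝ, 0 ≤ r ∧ A = Metric.closedBall x r)
    (hB : B = ∅ ∨ ∃ r : ℝ, 0 ≤ r ∧ B = Metric.closedBall x r) : A ⊆ B ∨ B ⊆ A := by
  rcases hA with rfl | ⟨r, -, rfl⟩
  · simp
  rcases hB with rfl | ⟨s, -, rfl⟩
  · simp
  exact (le_total r s).imp Metric.closedBall_subset_closedBall Metric.closedBall_subset_closedBall

/-- Contraction property of symmetrization around a point: if `g₁, g₂` have superlevel sets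
`{gᵢ ≥ λ}` that are (empty or) closed balls centered at `x` with
`μ({gᵢ ≥ λ}) = μ({fᵢ ≥ λ}) < ∞` for every `λ > 0`, then
`∫ |g₁ − g₂| dμ ≤ ∫ |f₁ − f₂| dμ`. -/
theorem stmt_5 (μ : Measure (EuclideanSpace ℝ (Fin 2)))
    (x : EuclideanSpace ℝ (Fin 2))
    (f₁ f₂ g₁ g₂ : EuclideanSpace ℝ (Fin 2) → ℝ)
    (hf₁_meas : Measurable f₁) (hf₂_meas : Measurable f₂)
    (hg₁_meas : Measurable g₁) (hg₂_meas : Measurable g₂)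
    (hf₁_nonneg : ∀ y, 0 ≤ f₁ y) (hf₂_nonneg : ∀ y, 0 ≤ f₂ y)
    (hg₁_nonneg : ∀ y, 0 ≤ g₁ y) (hg₂_nonneg : ∀ y, 0 ≤ g₂ y)
    (hball₁ : ∀ lam : ℝ, 0 < lam →
      ({y | lam ≤ g₁ y} = ∅ ∨ ∃ r : ℝ, 0 ≤ r ∧ {y | lam ≤ g₁ y} = Metric.closedBall x r))
    (hball₂ : ∀ lam : ℝ, 0 < lam →
      ({y | lam ≤ g₂ y} = ∅ ∨ ∃ r : ℝ, 0 ≤ r ∧ {y | lam ≤ g₂ y} = Metric.closedBall x r))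
    (hmeas₁ : ∀ lam : ℝ, 0 < lam →
      μ {y | lam ≤ g₁ y} = μ {y | lam ≤ f₁ y} ∧ μ {y | lam ≤ f₁ y} < ⊤)
    (hmeas₂ : ∀ lam : ℝ, 0 < lam →
      μ {y | lam ≤ g₂ y} = μ {y | lam ≤ f₂ y} ∧ μ {y | lam ≤ f₂ y} < ⊤) :
    ∫⁻ y, ENNReal.ofReal |g₁ y - g₂ y| ∂μ ≤ ∫⁻ y, ENNReal.ofReal |f₁ y - f₂ y| ∂μ := by
  rw [lintegral_abs_sub_eq_lintegral_measure_uIoc μ hg₁_meas hg₂_meas hg₁_nonneg hg₂_nonneg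
      (fun t ht => (hmeas₁ t ht).1 ▸ (hmeas₁ t ht).2)
      (fun t ht => (hmeas₂ t ht).1 ▸ (hmeas₂ t ht).2),
    lintegral_abs_sub_eq_lintegral_measure_uIoc μ hf₁_meas hf₂_meas hf₁_nonneg hf₂_nonneg
      (fun t ht => (hmeas₁ t ht).2) (fun t ht => (hmeas₂ t ht).2)]
  refine lintegral_mono fun t => ?_
  simp only [setOf_mem_uIoc_eq_symmDiff]
  rcases le_or_gt t 0 with ht | ht
  · simp [fun y => ht.trans (hg₁_nonneg y), fun y => ht.trans (hg₂_nonneg y)]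
  obtain ⟨h₁, hfin₁⟩ := hmeas₁ t ht
  obtain ⟨h₂, hfin₂⟩ := hmeas₂ t ht
  rcases subset_or_subset_of_closedBall (hball₁ t ht) (hball₂ t ht) with h | h
  · exact measure_symmDiff_le_of_subset (measurableSet_le measurable_const hg₁_meas) h h₁ h₂ hfin₁
  · rw [symmDiff_comm, symmDiff_comm {y | t ≤ f₁ y}]
    exact measure_symmDiff_le_of_subset (measurableSet_le measurable_const hg₂_meas) h h₂ h₁ hfin₂
end

section
/- Let V be a real normed vector space, let K ⊆ V be a convex set, let Φ : V → ℝ be strictly convex on K, and let L : V → ℝ be a linear map such that Φ(z) − Φ(ζ) ≥ L(z) − L(ζ) for all z ∈ K, where ζ ∈ K is a point maximizing Φ over K (i.e. Φ(z) ≤ Φ(ζ) for all z ∈ K). Then ζ is the unique maximizer of L over K; more precisely, for every z ∈ K with z ≠ ζ one has L(z) < L(ζ). -/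
open Set

/-- If `ζ` maximizes a strictly convex functional `Φ` over a convex set `K` and the linear
map `L` satisfies `Φ(z) − Φ(ζ) ≥ L(z) − L(ζ)` on `K`, then `ζ` is the unique maximizer of
`L` over `K`: for every `z ∈ K` with `z ≠ ζ`, `L(z) < L(ζ)`. -/
theorem stmt_6 {V : Type*} [NormedAddCommGroup V] [NormedSpace ℝ V]
    (K : Set V) (hK : Convex ℝ K)
    (Φ : V → ℝ) (hΦ : StrictConvexOn ℝ K Φ)
    (L : V →ₗ[ℝ] ℝ)
    (ζ : V) (hζ : ζ ∈ K)
    (hmax : ∀ z ∈ K, Φ z ≤ Φ ζ)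
    (hsub : ∀ z ∈ K, Φ z - Φ ζ ≥ L z - L ζ) :
    ∀ z ∈ K, z ≠ ζ → L z < L ζ := by
  intro z hz hne
  have hmid := hΦ.2 hz hζ hne (one_half_pos (α := ℝ)) one_half_pos (add_halves 1)
  have hmem := hK hz hζ (one_half_pos (α := ℝ)).le one_half_pos.le (add_halves 1)
  have hle := hsub _ hmem
  simp only [map_add, map_smul, smul_eq_mul] at hmid hle
  linarith [hmax z hz]
end

section
/- Let w, y, z ∈ ℝ² and r > 0 satisfy ‖y − z‖ ≥ r and ‖w − z‖ ≥ r. Then ‖(‖y − z‖/r)·(w − z) − (r/‖y − z‖)·(y − z)‖ ≥ ‖w − y‖; moreover, if ‖w − z‖ = r, then equality holds: ‖(‖y − z‖/r)·(w − z) − (r/‖y − z‖)·(y − z)‖ = ‖w − y‖. -/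
open RealInnerProductSpace

/-- The defect between the reflected distance and the distance itself factors. -/
theorem norm_smul_sub_smul_sq_sub_norm_sub_sq {E : Type*} [NormedAddCommGroup E]
    [InnerProductSpace ℝ E] (a b : E) {r : ℝ} (hr : r ≠ 0) (hb : ‖b‖ ≠ 0) :
    ‖(‖b‖ / r) • a - (r / ‖b‖) • b‖ ^ 2 - ‖a - b‖ ^ 2 =
      (‖b‖ ^ 2 - r ^ 2) * (‖a‖ ^ 2 - r ^ 2) / r ^ 2 := by
  rw [norm_sub_sq_real, norm_sub_sq_real, real_inner_smul_left, real_inner_smul_right,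
    norm_smul, norm_smul, mul_pow, mul_pow, Real.norm_eq_abs, Real.norm_eq_abs, sq_abs, sq_abs]
  field_simp
  ring

/-- If `‖y − z‖ ≥ r` and `‖w − z‖ ≥ r` with `r > 0`, then
`‖(‖y−z‖/r)(w−z) − (r/‖y−z‖)(y−z)‖ ≥ ‖w − y‖`, with equality when `‖w − z‖ = r`. -/
theorem stmt_12 (w y z : EuclideanSpace ℝ (Fin 2)) (r : ℝ) (hr : 0 < r)
    (hyz : r ≤ ‖y - z‖) (hwz : r ≤ ‖w - z‖) :
    ‖w - y‖ ≤ ‖(‖y - z‖ / r) • (w - z) - (r / ‖y - z‖) • (y - z)‖ ∧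
      (‖w - z‖ = r →
        ‖(‖y - z‖ / r) • (w - z) - (r / ‖y - z‖) • (y - z)‖ = ‖w - y‖) := by
  have h := norm_smul_sub_smul_sq_sub_norm_sub_sq (w - z) (y - z) hr.ne' (hr.trans_le hyz).ne'
  rw [sub_sub_sub_cancel_right] at h
  constructor
  · refine (sq_le_sq₀ (norm_nonneg _) (norm_nonneg _)).mp (sub_nonneg.mp ?_)
    rw [h]
    exact div_nonneg (mul_nonneg (sub_nonneg.mpr (pow_le_pow_left₀ hr.le hyz 2))
      (sub_nonneg.mpr (pow_le_pow_left₀ hr.le hwz 2))) (sq_nonneg r)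
  · intro hw
    rw [hw, sub_self, mul_zero, zero_div, sub_eq_zero] at h
    exact (sq_eq_sq₀ (norm_nonneg _) (norm_nonneg _)).mp h
end

section
/- Support-dependent Sobolev (Ladyzhenskaya-type) inequality in the plane: let q* > 2. There exists a constant C > 0 (depending only on q*) such that for every continuously differentiable function u : ℝ² → ℝ with compact support one has ‖u‖_{L^{q*}(ℝ²)} ≤ C · m({x : u(x) ≠ 0})^{1/q*} · ‖∇u‖_{L²(ℝ²)}, where m denotes two-dimensional Lebesgue measure. -/
open MeasureTheory Real

open scoped ENNReal NNReal

/-- Comparison of the integrals of the powers `q - 2` and `q` of a function, in terms of the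
measure of the set where it does not vanish. -/
lemma lintegral_rpow_sub_two_le {α : Type*} [MeasurableSpace α] (μ : Measure α) {q : ℝ}
    (hq : 2 < q) {f : α → ℝ≥0∞} (hf : Measurable f) :
    ∫⁻ x, f x ^ (q - 2) ∂μ ≤
      (∫⁻ x, f x ^ q ∂μ) ^ ((q - 2) / q) * μ {x | f x ≠ 0} ^ (2 / q) := by
  have hq0 : 0 < q := by linarith
  have hq2 : 0 < q - 2 := by linarith
  have hS : MeasurableSet {x | f x ≠ 0} := (hf (measurableSet_singleton 0)).compl
  have hconj : Real.HolderConjugate (q / (q - 2)) (q / 2) := by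
    rw [Real.holderConjugate_iff]
    constructor
    · rw [lt_div_iff₀ hq2]; linarith
    · field_simp; ring
  calc ∫⁻ x, f x ^ (q - 2) ∂μ
      = ∫⁻ x, f x ^ (q - 2) * {x | f x ≠ 0}.indicator 1 x ∂μ := by
        congr with x
        by_cases hx : f x = 0 <;> simp [hx, hq2]
    _ ≤ (∫⁻ x, (f x ^ (q - 2)) ^ (q / (q - 2)) ∂μ) ^ (1 / (q / (q - 2))) *
          (∫⁻ x, ({x | f x ≠ 0}.indicator 1 x : ℝ≥0∞) ^ (q / 2) ∂μ) ^ (1 / (q / 2)) :=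
        ENNReal.lintegral_mul_le_Lp_mul_Lq μ hconj (hf.pow_const _).aemeasurable
          (measurable_one.indicator hS).aemeasurable
    _ = (∫⁻ x, f x ^ q ∂μ) ^ ((q - 2) / q) * μ {x | f x ≠ 0} ^ (2 / q) := by
        have h : ∀ x, ({x | f x ≠ 0}.indicator 1 x : ℝ≥0∞) ^ (q / 2) =
            {x | f x ≠ 0}.indicator 1 x := fun x ↦ by
          by_cases hx : f x = 0 <;> simp [hx, hq0]
        simp_rw [h, lintegral_indicator_one hS, ← ENNReal.rpow_mul, one_div_div]
        rw [mul_div_cancel₀ _ hq2.ne']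

/-- Integrated form of the support-dependent Sobolev inequality in dimension two: the power
`|u| ^ (q / 2)` is inserted in the Gagliardo-Nirenberg-Sobolev inequality for `W^{1,1}`. -/
lemma lintegral_rpow_le_measure_support_mul_lintegral_fderiv {E : Type*} [NormedAddCommGroup E]
    [NormedSpace ℝ E] [MeasurableSpace E] [BorelSpace E] [FiniteDimensional ℝ E]
    (μ : Measure E) [μ.IsAddHaarMeasure] (hE : Module.finrank ℝ E = 2)
    {q : ℝ} (hq : 2 < q) {u : E → ℝ} (hu : ContDiff ℝ 1 u) (h2u : HasCompactSupport u) :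
    ∫⁻ x, ‖u x‖ₑ ^ q ∂μ ≤
      lintegralPowLePowLIntegralFDerivConst μ 2 * ENNReal.ofReal (q / 2) ^ (2 : ℝ) *
        ((∫⁻ x, ‖u x‖ₑ ^ q ∂μ) ^ ((q - 2) / q) * μ {x | u x ≠ 0} ^ (2 / q) *
          ∫⁻ x, ‖fderiv ℝ u x‖ₑ ^ (2 : ℝ) ∂μ) := by
  let γ : ℝ≥0 := (q / 2).toNNReal
  have hγ : (γ : ℝ) = q / 2 := Real.coe_toNNReal _ (by linarith)
  have h1γ : 1 < (γ : ℝ) := by rw [hγ]; linarith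
  have hcu := hu.continuous
  let v : E → ℝ := fun x ↦ ‖u x‖ ^ (γ : ℝ)
  have hv : ContDiff ℝ 1 v := hu.norm_rpow h1γ
  have h2v : HasCompactSupport v := h2u.norm.rpow_const (by linarith)
  have hgns := lintegral_pow_le_pow_lintegral_fderiv μ hv h2v (p := 2) (by
    rw [hE]; exact_mod_cast Real.HolderConjugate.two_two)
  have hI : ∫⁻ x, ‖u x‖ₑ ^ q ∂μ = ∫⁻ x, ‖v x‖ₑ ^ (2 : ℝ) ∂μ := by
    congr with x
    simp only [v]
    rw [Real.enorm_rpow_of_nonneg (norm_nonneg _) γ.coe_nonneg, enorm_norm, ← ENNReal.rpow_mul, hγ]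
    congr 1; ring
  have hgrad : ∫⁻ x, ‖fderiv ℝ v x‖ₑ ∂μ ≤ ENNReal.ofReal (q / 2) *
      ((∫⁻ x, ‖u x‖ₑ ^ (q - 2) ∂μ) ^ (1 / 2 : ℝ) *
        (∫⁻ x, ‖fderiv ℝ u x‖ₑ ^ (2 : ℝ) ∂μ) ^ (1 / 2 : ℝ)) := by
    calc ∫⁻ x, ‖fderiv ℝ v x‖ₑ ∂μ
        ≤ ∫⁻ x, γ * (‖u x‖ₑ ^ ((γ : ℝ) - 1) * ‖fderiv ℝ u x‖ₑ) ∂μ := by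
          gcongr with x
          rw [← mul_assoc]
          exact enorm_fderiv_norm_rpow_le (hu.differentiable one_ne_zero) h1γ
      _ = γ * ∫⁻ x, ‖u x‖ₑ ^ ((γ : ℝ) - 1) * ‖fderiv ℝ u x‖ₑ ∂μ := by
          rw [lintegral_const_mul']
          exact ENNReal.coe_ne_top
      _ ≤ _ := by
          refine mul_le_mul_right ?_ _
          convert! ENNReal.lintegral_mul_le_Lp_mul_Lq μ Real.HolderConjugate.two_two
            (f := fun x ↦ ‖u x‖ₑ ^ ((γ : ℝ) - 1)) (g := fun x ↦ ‖fderiv ℝ u x‖ₑ)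
            ?_ ?_ using 5 with x
          · rw [← ENNReal.rpow_mul, hγ]
            congr 1; ring
          · fun_prop
          · fun_prop
  have hlow := lintegral_rpow_sub_two_le μ hq (f := fun x ↦ ‖u x‖ₑ) (by fun_prop)
  simp only [ne_eq, enorm_eq_zero] at hlow
  calc ∫⁻ x, ‖u x‖ₑ ^ q ∂μ
      ≤ lintegralPowLePowLIntegralFDerivConst μ 2 *
          (ENNReal.ofReal (q / 2) * ((∫⁻ x, ‖u x‖ₑ ^ (q - 2) ∂μ) ^ (1 / 2 : ℝ) *
            (∫⁻ x, ‖fderiv ℝ u x‖ₑ ^ (2 : ℝ) ∂μ) ^ (1 / 2 : ℝ))) ^ (2 : ℝ) := by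
        rw [hI]
        exact hgns.trans (by gcongr)
    _ = lintegralPowLePowLIntegralFDerivConst μ 2 * ENNReal.ofReal (q / 2) ^ (2 : ℝ) *
          ((∫⁻ x, ‖u x‖ₑ ^ (q - 2) ∂μ) * ∫⁻ x, ‖fderiv ℝ u x‖ₑ ^ (2 : ℝ) ∂μ) := by
        simp only [ENNReal.mul_rpow_of_nonneg _ _ zero_le_two, ← ENNReal.rpow_mul]
        norm_num [mul_assoc]
    _ ≤ _ := by gcongr

/-- Support-dependent Sobolev (Ladyzhenskaya-type) inequality in the plane: for `q* > 2`
there is `C > 0` such that for every `C¹` compactly supported `u : ℝ² → ℝ`,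
`‖u‖_{L^{q*}} ≤ C · m({u ≠ 0})^{1/q*} · ‖∇u‖_{L²}`. -/
theorem stmt_15 (q : ℝ) (hq : 2 < q) :
    ∃ C : ℝ, 0 < C ∧
      ∀ u : EuclideanSpace ℝ (Fin 2) → ℝ,
        ContDiff ℝ 1 u → HasCompactSupport u →
        eLpNorm u (ENNReal.ofReal q) volume ≤
          ENNReal.ofReal C * (volume {x | u x ≠ 0}) ^ (1 / q) *
            eLpNorm (fun x => ‖fderiv ℝ u x‖) 2 volume := by
  have hq0 : 0 < q := by linarith
  let K : ℝ≥0 :=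
    lintegralPowLePowLIntegralFDerivConst (volume : Measure (EuclideanSpace ℝ (Fin 2))) 2
  refine ⟨(K : ℝ) ^ (1 / 2 : ℝ) * (q / 2) + 1, by positivity, fun u hu h2u ↦ ?_⟩
  have hqtop : ENNReal.ofReal q ≠ ∞ := ENNReal.ofReal_ne_top
  have hqne : ENNReal.ofReal q ≠ 0 := by simpa using hq0
  have hqr : (ENNReal.ofReal q).toReal = q := ENNReal.toReal_ofReal hq0.le
  have hmain := lintegral_rpow_le_measure_support_mul_lintegral_fderiv volume (by simp) hq hu h2u
  have hfin : ∫⁻ x, ‖u x‖ₑ ^ q ≠ ∞ := by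
    have := lintegral_rpow_enorm_lt_top_of_eLpNorm_lt_top hqne hqtop
      (hu.continuous.memLp_of_hasCompactSupport (μ := volume) h2u).eLpNorm_lt_top
    rw [hqr] at this
    exact this.ne
  rw [eLpNorm_norm, eLpNorm_eq_lintegral_rpow_enorm_toReal hqne hqtop,
    eLpNorm_eq_lintegral_rpow_enorm_toReal two_ne_zero ENNReal.ofNat_ne_top, hqr,
    ENNReal.toReal_ofNat]
  set I := ∫⁻ x, ‖u x‖ₑ ^ q
  set D := ∫⁻ x, ‖fderiv ℝ u x‖ₑ ^ (2 : ℝ)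
  set m := volume {x | u x ≠ 0}
  rcases eq_or_ne I 0 with hI | hI
  · simp [hI, hq0]
  have hsq : I ^ (2 / q) ≤ K * ENNReal.ofReal (q / 2) ^ (2 : ℝ) * (m ^ (2 / q) * D) := by
    have he : 2 / q = 1 - (q - 2) / q := by field_simp; ring
    conv_lhs => rw [he]
    rw [ENNReal.rpow_sub _ _ hI hfin, ENNReal.rpow_one]
    refine ENNReal.div_le_of_le_mul (hmain.trans_eq ?_)
    ring
  calc I ^ (1 / q) = (I ^ (2 / q)) ^ (1 / 2 : ℝ) := by
        rw [← ENNReal.rpow_mul]; congr 1; ring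
    _ ≤ (K * ENNReal.ofReal (q / 2) ^ (2 : ℝ) * (m ^ (2 / q) * D)) ^ (1 / 2 : ℝ) := by gcongr
    _ = ENNReal.ofReal ((K : ℝ) ^ (1 / 2 : ℝ) * (q / 2)) * m ^ (1 / q) * D ^ (1 / 2 : ℝ) := by
        have h2 : (0 : ℝ) ≤ 1 / 2 := by norm_num
        have he : 2 / q * (1 / 2) = 1 / q := by ring
        simp only [ENNReal.mul_rpow_of_nonneg _ _ h2, ← ENNReal.rpow_mul, he]
        rw [ENNReal.ofReal_mul (by positivity), ← ENNReal.ofReal_rpow_of_nonneg K.coe_nonneg h2,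
          ENNReal.ofReal_coe_nnreal]
        norm_num [mul_assoc]
    _ ≤ _ := by gcongr; linarith
end
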